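/- arXiv:2006.16351 — 3 statements merged into one kernel-verified Lean document; each statement's English description precedes it below -/
import Mathlib

section
/- Let ε > 0 and write I := (-ε, ε). Let C̄ > 0 and let (μ_k)_{k∈ℕ} be finite Borel measures on ℝ with μ_k(ℝ) ≤ C̄ for all k. For each t ∈ I and k ∈ ℕ let I(t,k) ⊆ ℝ be an open interval containing t, and assume that d_k := sup_{t∈I} diam(I(t,k)) → 0 as k → ∞. Then there exist a sequence (f_m)_{m≥0} of strictly increasing maps ℕ → ℕ and a sequence (L_m)_{m≥0} of finite subsets of the closure of I, with the following properties: (1) L₀ = ∅ and f₀(k) = k for all k; (2) for every m ≥ 1, L_{m-1} ⊆ L_m and f_m(ℕ) ⊆ f_{m-1}(ℕ); (3) for every m ≥ 0 and every t ∈ L_m ∩ I there exists a sequence (τ_k) ⊆ I converging to t such that the limit lim_{k→∞} μ_{f_m(k)}(I(τ_k, f_m(k))) exists and is strictly greater than C̄/2^m; (4) for every m ≥ 0 and every t ∈ I \ L_m, there is no sequence (τ_k) ⊆ I converging to t with limsup_{k→∞} μ_{f_m(k)}(I(τ_k, f_m(k))) > C̄/2^m. -/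
open Filter MeasureTheory

section Concentration

variable {X : Type*} [TopologicalSpace X]

/-- Along the indices `f`, the quantities `F · (f k)` taken at suitable points of `I` converging
to `t` have a limit exceeding `a`. -/
def ConcentratesAt (I : Set X) (F : X → ℕ → ENNReal) (a : ENNReal) (f : ℕ → ℕ) (t : X) : Prop :=
  ∃ τ : ℕ → X, (∀ k, τ k ∈ I) ∧ Tendsto τ atTop (nhds t) ∧
    ∃ A : ENNReal, Tendsto (fun k => F (τ k) (f k)) atTop (nhds A) ∧ a < A

/-- Along the indices `f`, the quantities `F · (f k)` taken at suitable points of `I` converging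
to `t` have upper limit exceeding `a`. -/
def LimsupConcentratesAt (I : Set X) (F : X → ℕ → ENNReal) (a : ENNReal) (f : ℕ → ℕ) (t : X) :
    Prop :=
  ∃ τ : ℕ → X, (∀ k, τ k ∈ I) ∧ Tendsto τ atTop (nhds t) ∧
    a < atTop.limsup (fun k => F (τ k) (f k))

variable {I : Set X} {F : X → ℕ → ENNReal} {a b : ENNReal} {f φ : ℕ → ℕ} {t : X}

theorem ConcentratesAt.comp (h : ConcentratesAt I F a f t) (hφ : StrictMono φ) :
    ConcentratesAt I F a (f ∘ φ) t := by
  obtain ⟨τ, hτ, hlim, A, hA, hlt⟩ := h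
  exact ⟨τ ∘ φ, fun k => hτ _, hlim.comp hφ.tendsto_atTop, A, hA.comp hφ.tendsto_atTop, hlt⟩

theorem ConcentratesAt.mono (h : ConcentratesAt I F a f t) (hab : b ≤ a) :
    ConcentratesAt I F b f t := by
  obtain ⟨τ, hτ, hlim, A, hA, hlt⟩ := h
  exact ⟨τ, hτ, hlim, A, hA, hab.trans_lt hlt⟩

theorem ENNReal.exists_subseq_tendsto_of_lt_limsup {u : ℕ → ENNReal} (h : a < atTop.limsup u) :
    ∃ φ : ℕ → ℕ, StrictMono φ ∧ ∃ A, Tendsto (u ∘ φ) atTop (nhds A) ∧ a < A := by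
  obtain ⟨b, hab, hb⟩ := exists_between h
  obtain ⟨φ, hφ, hbφ⟩ := extraction_of_frequently_atTop
    (frequently_lt_of_lt_limsup (by isBoundedDefault) hb)
  obtain ⟨A, ψ, hψ, hA⟩ := CompactSpace.tendsto_subseq (u ∘ φ)
  exact ⟨φ ∘ ψ, hφ.comp hψ, A, hA, hab.trans_le (ge_of_tendsto' hA fun k => (hbφ (ψ k)).le)⟩

theorem LimsupConcentratesAt.exists_subseq (h : LimsupConcentratesAt I F a f t) :
    ∃ φ : ℕ → ℕ, StrictMono φ ∧ ConcentratesAt I F a (f ∘ φ) t := by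
  obtain ⟨τ, hτ, hlim, hlt⟩ := h
  obtain ⟨φ, hφ, A, hA, haA⟩ := ENNReal.exists_subseq_tendsto_of_lt_limsup hlt
  exact ⟨φ, hφ, τ ∘ φ, fun k => hτ _, hlim.comp hφ.tendsto_atTop, A, hA, haA⟩

/-- If the number of concentration points along any subsequence is bounded, then some subsequence
has a finite set of concentration points outside of which not even the upper limits
concentrate. -/
theorem exists_subseq_forall_not_limsupConcentratesAt {N : ℕ}
    (hN : ∀ g : ℕ → ℕ, StrictMono g → ∀ T : Finset X, (∀ t ∈ T, ConcentratesAt I F a g t) →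
      T.card ≤ N)
    (hf : StrictMono f) (S : Finset X) (hSI : ↑S ⊆ I) (hS : ∀ t ∈ S, ConcentratesAt I F a f t) :
    ∃ φ : ℕ → ℕ, StrictMono φ ∧ ∃ T : Finset X, S ⊆ T ∧ ↑T ⊆ I ∧
      (∀ t ∈ T, ConcentratesAt I F a (f ∘ φ) t) ∧
      ∀ t ∈ I \ ↑T, ¬ LimsupConcentratesAt I F a (f ∘ φ) t := by
  classical
  induction hn : N - S.card using Nat.strong_induction_on generalizing f S with
  | _ n ih =>
    by_cases hex : ∃ t ∈ I \ ↑S, LimsupConcentratesAt I F a f t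
    · obtain ⟨t, ⟨htI, htS⟩, ht⟩ := hex
      obtain ⟨φ, hφ, hconc⟩ := ht.exists_subseq
      have hS' : ∀ s ∈ insert t S, ConcentratesAt I F a (f ∘ φ) s := by
        intro s hs
        rcases Finset.mem_insert.1 hs with rfl | hs
        · exact hconc
        · exact (hS s hs).comp hφ
      have hcard := Finset.card_insert_of_notMem (Finset.mem_coe.not.1 htS)
      have hle := hN _ (hf.comp hφ) _ hS'
      obtain ⟨ψ, hψ, T, hST, hTI, hT, hmax⟩ := ih _ (by omega) (hf.comp hφ) (insert t S)
        (by rw [Finset.coe_insert]; exact Set.insert_subset htI hSI) hS' rfl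
      exact ⟨φ ∘ ψ, hφ.comp hψ, T, (Finset.subset_insert t S).trans hST, hTI, hT, hmax⟩
    · exact ⟨id, strictMono_id, S, subset_rfl, hSI, hS, fun t ht h => hex ⟨t, ht, h⟩⟩

/-- Concentration points of windows shrinking to points carry disjoint portions of the mass. -/
theorem card_mul_le_of_concentratesAt [T2Space X] [MeasurableSpace X] {μ : ℕ → Measure X}
    {J : X → ℕ → Set X} {M : ENNReal} (hμ : ∀ k, μ k Set.univ ≤ M)
    (hJ : ∀ t ∈ I, ∀ k, MeasurableSet (J t k))
    (hshrink : ∀ (τ : ℕ → X) (t : X), (∀ k, τ k ∈ I) → Tendsto τ atTop (nhds t) →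
      Tendsto (fun k => J (τ k) (f k)) atTop (nhds t).smallSets)
    (T : Finset X) (hT : ∀ t ∈ T, ConcentratesAt I (fun t k => μ k (J t k)) a f t) :
    T.card * a ≤ M := by
  obtain ⟨U, hU, hdisj⟩ := T.finite_toSet.t2_separation
  choose! τ hτ hlim A hA hlt using hT
  have hsub : ∀ᶠ k in atTop, ∀ t ∈ T, J (τ t k) (f k) ⊆ U t :=
    (Finset.eventually_all T).2 fun t ht => tendsto_smallSets_iff.1
      (hshrink (τ t) t (hτ t ht) (hlim t ht)) _ ((hU t).2.mem_nhds (hU t).1)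
  have hmass : ∀ᶠ k in atTop, ∀ t ∈ T, a < μ (f k) (J (τ t k) (f k)) :=
    (Finset.eventually_all T).2 fun t ht => (hA t ht).eventually_const_lt (hlt t ht)
  obtain ⟨k, hk, hk'⟩ := (hsub.and hmass).exists
  calc T.card * a = ∑ _t ∈ T, a := by simp
    _ ≤ ∑ t ∈ T, μ (f k) (J (τ t k) (f k)) := Finset.sum_le_sum fun t ht => (hk' t ht).le
    _ = μ (f k) (⋃ t ∈ T, J (τ t k) (f k)) :=
      (measure_biUnion_finset (fun s hs t ht hst => (hdisj hs ht hst).mono (hk s hs) (hk t ht))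
        fun t ht => hJ _ (hτ t ht k) _).symm
    _ ≤ M := (measure_mono (Set.subset_univ _)).trans (hμ _)

end Concentration

/-- Bounded windows around convergent points shrink to the limit when their diameters do. -/
theorem tendsto_smallSets_of_diam_le {X : Type*} [PseudoMetricSpace X] {I : Set X}
    {J : X → ℕ → Set X} (hmem : ∀ t ∈ I, ∀ k, t ∈ J t k)
    (hbdd : ∀ t ∈ I, ∀ k, Bornology.IsBounded (J t k))
    (hdiam : ∀ η > (0:ℝ), ∃ K, ∀ k ≥ K, ∀ t ∈ I, Metric.diam (J t k) ≤ η)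
    {f : ℕ → ℕ} (hf : Tendsto f atTop atTop) {τ : ℕ → X} {t : X} (hτ : ∀ k, τ k ∈ I)
    (hlim : Tendsto τ atTop (nhds t)) :
    Tendsto (fun k => J (τ k) (f k)) atTop (nhds t).smallSets := by
  refine (Metric.nhds_basis_ball.smallSets.tendsto_right_iff).2 fun r hr => ?_
  obtain ⟨K, hK⟩ := hdiam (r / 2) (half_pos hr)
  filter_upwards [hf.eventually_ge_atTop K, Metric.tendsto_nhds.1 hlim (r / 2) (half_pos hr)]
    with k hk hk' x hx
  have := Metric.dist_le_diam_of_mem (hbdd _ (hτ k) (f k)) hx (hmem _ (hτ k) (f k))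
  have := hK _ hk _ (hτ k)
  have := dist_triangle x (τ k) t
  rw [Metric.mem_ball]
  linarith

/-- the key inductive construction, in measure-theoretic form: nested
subsequences `f m` and finite exceptional sets `L m ⊆ cl(I)` so that mass greater than
`C̄/2^m` concentrates (along the subsequence `f m`, in the shrinking windows `J τ k`)
exactly near the points of `L m`. -/
theorem stmt_6 (ε : ℝ) (hε : 0 < ε) (Cbar : ℝ) (hC : 0 < Cbar)
    (μ : ℕ → Measure ℝ) (hμ : ∀ k, μ k Set.univ ≤ ENNReal.ofReal Cbar)
    (J : ℝ → ℕ → Set ℝ)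
    (hJ : ∀ t ∈ Set.Ioo (-ε) ε, ∀ k : ℕ, t ∈ J t k ∧ ∃ p q : ℝ, J t k = Set.Ioo p q)
    (hdiam : ∀ η > (0:ℝ), ∃ K, ∀ k ≥ K, ∀ t ∈ Set.Ioo (-ε) ε, Metric.diam (J t k) ≤ η) :
    ∃ (f : ℕ → ℕ → ℕ) (L : ℕ → Set ℝ),
      (∀ m, StrictMono (f m)) ∧
      (∀ m, (L m).Finite ∧ L m ⊆ Set.Icc (-ε) ε) ∧
      (L 0 = ∅) ∧ (∀ k, f 0 k = k) ∧
      (∀ m, L m ⊆ L (m + 1)) ∧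
      (∀ m, Set.range (f (m + 1)) ⊆ Set.range (f m)) ∧
      (∀ m, ∀ t ∈ L m ∩ Set.Ioo (-ε) ε,
        ∃ τ : ℕ → ℝ, (∀ k, τ k ∈ Set.Ioo (-ε) ε) ∧
          Tendsto τ atTop (nhds t) ∧
          ∃ A : ENNReal,
            Tendsto (fun k => μ (f m k) (J (τ k) (f m k))) atTop (nhds A) ∧
            ENNReal.ofReal (Cbar / 2 ^ m) < A) ∧
      (∀ m, ∀ t ∈ Set.Ioo (-ε) ε \ L m,
        ¬ ∃ τ : ℕ → ℝ, (∀ k, τ k ∈ Set.Ioo (-ε) ε) ∧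
          Tendsto τ atTop (nhds t) ∧
          ENNReal.ofReal (Cbar / 2 ^ m) <
            atTop.limsup (fun k => μ (f m k) (J (τ k) (f m k)))) := by
  set I := Set.Ioo (-ε) ε
  let F : ℝ → ℕ → ENNReal := fun t k => μ k (J t k)
  let a : ℕ → ENNReal := fun m => ENNReal.ofReal (Cbar / 2 ^ m)
  have hanti : ∀ m, a (m + 1) ≤ a m := fun m => ENNReal.ofReal_le_ofReal <|
    div_le_div_of_nonneg_left hC.le (by positivity) (pow_le_pow_right₀ one_le_two m.le_succ)
  have hcard : ∀ m (g : ℕ → ℕ), StrictMono g → ∀ T : Finset ℝ,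
      (∀ t ∈ T, ConcentratesAt I F (a m) g t) → T.card ≤ 2 ^ m := by
    intro m g hg T hT
    have h : (T.card : ENNReal) * a m ≤ ENNReal.ofReal Cbar := by
      refine card_mul_le_of_concentratesAt hμ (fun t ht k => ?_) (fun τ t hτ hlim => ?_) T hT
      · obtain ⟨p, q, hpq⟩ := (hJ t ht k).2
        exact hpq ▸ measurableSet_Ioo
      · refine tendsto_smallSets_of_diam_le (fun t ht k => (hJ t ht k).1) (fun t ht k => ?_) hdiam
          hg.tendsto_atTop hτ hlim
        obtain ⟨p, q, hpq⟩ := (hJ t ht k).2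
        exact hpq ▸ Metric.isBounded_Ioo p q
    rw [← ENNReal.ofReal_natCast, ← ENNReal.ofReal_mul (Nat.cast_nonneg _),
      ENNReal.ofReal_le_ofReal_iff hC.le, mul_div_left_comm,
      mul_le_iff_le_one_right hC, div_le_one (by positivity)] at h
    exact_mod_cast h
  let Good : ℕ → (ℕ → ℕ) × Finset ℝ → Prop := fun m p =>
    StrictMono p.1 ∧ ↑p.2 ⊆ I ∧ (∀ t ∈ p.2, ConcentratesAt I F (a m) p.1 t) ∧
      ∀ t ∈ I \ ↑p.2, ¬ LimsupConcentratesAt I F (a m) p.1 t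
  have hstart : Good 0 (id, ∅) := by
    refine ⟨strictMono_id, by simp, by simp, ?_⟩
    rintro t - ⟨τ, -, -, hlt⟩
    refine hlt.not_ge (limsup_le_of_le (by isBoundedDefault) (Eventually.of_forall fun k => ?_))
    simpa [F, a] using (measure_mono (Set.subset_univ _)).trans (hμ k)
  have hstep : ∀ m (p : {p // Good m p}), ∃ q : {q // Good (m + 1) q},
      p.1.2 ⊆ q.1.2 ∧ Set.range q.1.1 ⊆ Set.range p.1.1 := by
    rintro m ⟨⟨f, S⟩, hf, hSI, hS, -⟩
    obtain ⟨φ, hφ, T, hST, hTI, hT, hmax⟩ := exists_subseq_forall_not_limsupConcentratesAt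
      (hcard (m + 1)) hf S hSI fun t ht => (hS t ht).mono (hanti m)
    exact ⟨⟨(f ∘ φ, T), hf.comp hφ, hTI, hT, hmax⟩, hST, Set.range_comp_subset_range φ f⟩
  choose next hsub hrange using hstep
  let s : ∀ m, {p // Good m p} := fun m => Nat.rec ⟨(id, ∅), hstart⟩ next m
  refine ⟨fun m => (s m).1.1, fun m => ↑(s m).1.2, fun m => (s m).2.1,
    fun m => ⟨Finset.finite_toSet _, (s m).2.2.1.trans Set.Ioo_subset_Icc_self⟩,
    Finset.coe_empty, fun _ => rfl, fun m => Finset.coe_subset.2 (hsub m (s m)),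
    fun m => hrange m (s m), fun m t ht => (s m).2.2.2.1 t ht.1, fun m => (s m).2.2.2.2⟩
end

section
/- Let ε > 0 and write I := (-ε, ε). Let C̄ > 0 and let (μ_k)_{k∈ℕ} be finite Borel measures on ℝ with μ_k(ℝ) ≤ C̄ for all k. For each t ∈ I and k ∈ ℕ let I(t,k) ⊆ ℝ be an open interval containing t, and assume that sup_{t∈I} diam(I(t,k)) → 0 as k → ∞. Then there exist a sequence of indices (k_m)_{m∈ℕ} with k_m ≥ m for all m, and a countable set L contained in the closure of I, such that for every t ∈ I \ L one has lim_{m→∞} μ_{k_m}(I(t, k_m)) = 0. -/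
open Filter MeasureTheory

/-- A sequence of uniformly bounded measures on `ℝ` has a subsequence which, at all but countably
many points `t`, has eventually arbitrarily small mass on some neighbourhood of `t`. -/
theorem exists_subseq_countable_small_mass (μ : ℕ → Measure ℝ) {C : ENNReal} (hC : C ≠ ⊤)
    (hμ : ∀ k, μ k Set.univ ≤ C) :
    ∃ φ : ℕ → ℕ, StrictMono φ ∧ ∃ L : Set ℝ, L.Countable ∧ ∀ t ∉ L, ∀ η > (0 : ENNReal),
      ∃ a b : ℝ, a < t ∧ t < b ∧ ∀ᶠ m in atTop, μ (φ m) (Set.Ioc a b) < η := by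
  obtain ⟨F, φ, hφ, hF⟩ := CompactSpace.tendsto_subseq
    (fun k => (fun q : ℚ => μ k (Set.Iic (q : ℝ))))
  have hF' : ∀ q : ℚ, Tendsto (fun m => μ (φ m) (Set.Iic (q : ℝ))) atTop (nhds (F q)) :=
    fun q => tendsto_pi_nhds.1 hF q
  have hbound : ∀ k (s : Set ℝ), μ k s ≤ C := fun k s =>
    (measure_mono (Set.subset_univ s)).trans (hμ k)
  let G : ℝ → ENNReal := fun t => liminf (fun m => μ (φ m) (Set.Iic t)) atTop
  have hG : Monotone G := fun x y hxy =>
    liminf_le_liminf (Eventually.of_forall fun m => measure_mono (Set.Iic_subset_Iic.2 hxy))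
  have hGF : ∀ q : ℚ, G q = F q := fun q => (hF' q).liminf_eq
  have hG_top : ∀ t, G t ≠ ⊤ := fun t =>
    ne_top_of_le_ne_top hC <| (liminf_le_liminf (Eventually.of_forall fun m =>
      hbound (φ m) (Set.Iic t))).trans_eq (tendsto_const_nhds (x := C)).liminf_eq
  refine ⟨φ, hφ, {t | ¬ ContinuousAt G t}, hG.countable_not_continuousAt, fun t ht η hη => ?_⟩
  have hcont : ContinuousAt G t := not_not.1 ht
  have hsub : Tendsto (fun p : ℝ × ℝ => G p.2 - G p.1) (nhds t ×ˢ nhds t) (nhds 0) := by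
    have := ENNReal.Tendsto.sub (hcont.tendsto.comp (tendsto_snd (f := nhds t)))
      (hcont.tendsto.comp (tendsto_fst (g := nhds t))) (Or.inl (hG_top t))
    rwa [tsub_self] at this
  obtain ⟨P, hP, Q, hQ, hPQ⟩ := eventually_prod_iff.1 (hsub.eventually_lt_const hη)
  obtain ⟨δ₁, hδ₁, h₁⟩ := Metric.eventually_nhds_iff.1 hP
  obtain ⟨δ₂, hδ₂, h₂⟩ := Metric.eventually_nhds_iff.1 hQ
  obtain ⟨a, ha, hat⟩ := exists_rat_btwn (sub_lt_self t hδ₁)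
  obtain ⟨b, htb, hb⟩ := exists_rat_btwn (lt_add_of_pos_right t hδ₂)
  refine ⟨a, b, hat, htb, ?_⟩
  have hlt : F b - F a < η := by
    rw [← hGF, ← hGF]
    exact hPQ (h₁ (by rw [Real.dist_eq, abs_lt]; constructor <;> linarith))
      (h₂ (by rw [Real.dist_eq, abs_lt]; constructor <;> linarith))
  have hlim := ENNReal.Tendsto.sub (hF' b) (hF' a) (Or.inl (hGF b ▸ hG_top b))
  filter_upwards [hlim.eventually_lt_const hlt] with m hm
  rwa [← Set.Iic_sdiff_Iic, measure_sdiff (Set.Iic_subset_Iic.2 (hat.trans htb).le)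
    measurableSet_Iic.nullMeasurableSet (ne_top_of_le_ne_top hC (hbound _ _))]

/-- vanishing horizontal area, in measure-theoretic form: there exist a diagonal
sequence of indices `ks m ≥ m` and a countable set `L ⊆ cl(I)` such that away from `L` the
mass of `μ (ks m)` in the shrinking window around `t` tends to zero. -/
theorem stmt_7 (ε : ℝ) (hε : 0 < ε) (Cbar : ℝ) (hC : 0 < Cbar)
    (μ : ℕ → Measure ℝ) (hμ : ∀ k, μ k Set.univ ≤ ENNReal.ofReal Cbar)
    (J : ℝ → ℕ → Set ℝ)
    (hJ : ∀ t ∈ Set.Ioo (-ε) ε, ∀ k : ℕ, t ∈ J t k ∧ ∃ p q : ℝ, J t k = Set.Ioo p q)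
    (hdiam : ∀ η > (0:ℝ), ∃ K, ∀ k ≥ K, ∀ t ∈ Set.Ioo (-ε) ε, Metric.diam (J t k) ≤ η) :
    ∃ (ks : ℕ → ℕ) (L : Set ℝ),
      (∀ m, m ≤ ks m) ∧ L.Countable ∧ L ⊆ Set.Icc (-ε) ε ∧
      ∀ t ∈ Set.Ioo (-ε) ε \ L,
        Tendsto (fun m => μ (ks m) (J t (ks m))) atTop (nhds 0) := by
  obtain ⟨φ, hφ, L, hL, h⟩ := exists_subseq_countable_small_mass μ ENNReal.ofReal_ne_top hμ
  refine ⟨φ, L ∩ Set.Icc (-ε) ε, hφ.id_le, hL.mono Set.inter_subset_left,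
    Set.inter_subset_right, fun t ⟨htI, htL⟩ => ?_⟩
  replace htL : t ∉ L := fun ht => htL ⟨ht, Set.Ioo_subset_Icc_self htI⟩
  refine ENNReal.tendsto_nhds_zero.2 fun η hη => ?_
  obtain ⟨a, b, hat, htb, hev⟩ := h t htL η hη
  obtain ⟨δ, hδ, hδ_lt⟩ := exists_between (lt_min (sub_pos.2 hat) (sub_pos.2 htb))
  obtain ⟨hδa, hδb⟩ := lt_min_iff.1 hδ_lt
  obtain ⟨K, hK⟩ := hdiam δ hδ
  filter_upwards [hev, hφ.tendsto_atTop.eventually_ge_atTop K] with m hm hmK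
  refine (measure_mono fun x hx => ?_).trans hm.le
  obtain ⟨htJ, p, q, hpq⟩ := hJ t htI (φ m)
  have hbdd : Bornology.IsBounded (J t (φ m)) := hpq ▸ Metric.isBounded_Ioo p q
  have hdist := (Metric.dist_le_diam_of_mem hbdd hx htJ).trans (hK _ hmK t htI)
  rw [Real.dist_eq, abs_le] at hdist
  constructor <;> linarith
end

section
/- Let V be a real vector space, let Ω : V × V → ℝ be an alternating bilinear form, let σ, λ : V → ℝ be linear functionals, and let e, X ∈ V satisfy: σ(e) = 1, λ(e) = 0, σ(X) = 0, Ω(w, X) = σ(w) for all w ∈ V, and c := λ(X) > 0. Set X̂ := c⁻¹ X, let φ > 0 be a real number, and for v = a·e + b·X̂ (a, b ∈ ℝ) define Jv := (a/φ)·X̂ - (φ b)·e. Then, with (σ ∧ λ)(u, w) := σ(u)λ(w) - σ(w)λ(u), one has (σ ∧ λ)(v, Jv) = a²/φ + φ b² and Ω(v, Jv) = (a²/φ + φ b²)/c; in particular (σ ∧ λ)(v, Jv) = λ(X) · Ω(v, Jv). -/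
/-- the pointwise identity `(σ ∧ λ)(v, Jv) = a²/φ + φb²` and
`Ω(v, Jv) = (a²/φ + φb²)/λ(X)` for `v = a∂ₛ + bX̂` and a weakly adapted `J` on the plane
field spanned by `∂ₛ` and `X̂`. -/
theorem stmt_14 (V : Type*) [AddCommGroup V] [Module ℝ V]
    (Ω : V →ₗ[ℝ] V →ₗ[ℝ] ℝ) (halt : ∀ u : V, Ω u u = 0)
    (σ lam : V →ₗ[ℝ] ℝ) (e X : V)
    (hσe : σ e = 1) (hlame : lam e = 0) (hσX : σ X = 0)
    (hΩ : ∀ w : V, Ω w X = σ w) (hc : 0 < lam X)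
    (Xhat : V) (hXhat : Xhat = (lam X)⁻¹ • X)
    (φ : ℝ) (hφ : 0 < φ) (a b : ℝ) (v Jv : V)
    (hv : v = a • e + b • Xhat)
    (hJv : Jv = (a / φ) • Xhat - (φ * b) • e) :
    (σ v * lam Jv - σ Jv * lam v = a ^ 2 / φ + φ * b ^ 2) ∧
    (Ω v Jv = (a ^ 2 / φ + φ * b ^ 2) / lam X) ∧
    (σ v * lam Jv - σ Jv * lam v = lam X * Ω v Jv) := by
  have hXe : Ω X e = -1 := by
    rw [← LinearMap.IsAlt.neg (B := Ω) halt e X, hΩ, hσe]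
  have hc' : lam X ≠ 0 := hc.ne'
  have hφ' : φ ≠ 0 := hφ.ne'
  have hwedge : σ v * lam Jv - σ Jv * lam v = a ^ 2 / φ + φ * b ^ 2 := by
    subst hv hJv hXhat
    simp only [map_add, map_sub, map_smul, smul_eq_mul, hσe, hlame, hσX]
    field_simp
    ring
  have hform : Ω v Jv = (a ^ 2 / φ + φ * b ^ 2) / lam X := by
    subst hv hJv hXhat
    simp only [map_add, map_sub, map_smul, LinearMap.add_apply, LinearMap.smul_apply,
      smul_eq_mul, hΩ, hσe, hσX, hXe, halt]
    field_simp
    ring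
  exact ⟨hwedge, hform, by rw [hwedge, hform, mul_div_cancel₀ _ hc']⟩
end
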